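/- arXiv:2207.10041 — 2 statements merged into one kernel-verified Lean document; each statement's English description precedes it below -/
import Mathlib

section
/- Let C be a regular category, A an object of C, P a complete lattice, and H : P^op → RegEpi(A) a monotone map. The following are equivalent: (1) H preserves finite infima and arbitrary suprema, and any two regular epimorphisms in the image of H ker-commute; (2) the presheaf γ_*H : P^op → C is a C-valued K-sheaf on P and H(⊤) is an isomorphism in C. -/
open CategoryTheory CategoryTheory.Limits

universe w v u

class RegularCat (C : Type u) [Category.{v} C] [HasFiniteLimits C] : Prop where
  factor : ∀ {X Y : C} (f : X ⟶ Y), ∃ (Z : C) (e : X ⟶ Z) (m : Z ⟶ Y),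
      Nonempty (RegularEpi e) ∧ Mono m ∧ e ≫ m = f
  stable : ∀ {X Y Z : C} (f : X ⟶ Y) (g : Z ⟶ Y),
      Nonempty (RegularEpi f) → Nonempty (RegularEpi (pullback.snd f g))

variable {C : Type u} [Category.{v} C]

structure RegEpiOver (A : C) : Type (max u v) where
  cod : C
  hom : A ⟶ cod
  regEpi : Nonempty (RegularEpi hom)

/-- f ≤ g in RegEpi(A) iff g = h ∘ f for some h. -/
def RegEpiOver.le {A : C} (f g : RegEpiOver A) : Prop :=
  ∃ h : f.cod ⟶ g.cod, f.hom ≫ h = g.hom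

variable [HasFiniteLimits C]

/-- The kernel pair of f, as a map into A ⨯ A. -/
noncomputable def kerPairMap {A B : C} (f : A ⟶ B) : pullback f f ⟶ A ⨯ A :=
  prod.lift (pullback.fst f f) (pullback.snd f f)

/-- The object U in the construction of the composite of two relations r : R ↣ A × A and
s : S ↣ A × A: the equaliser of the two maps R ⨯ S ⟶ A given by the second leg of r and
the first leg of s. -/
noncomputable def relCompDom {A R S : C} (r : R ⟶ A ⨯ A) (s : S ⟶ A ⨯ A) : C :=
  equalizer ((prod.fst : R ⨯ S ⟶ R) ≫ r ≫ (prod.snd : A ⨯ A ⟶ A))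
    ((prod.snd : R ⨯ S ⟶ S) ≫ s ≫ (prod.fst : A ⨯ A ⟶ A))

/-- The canonical map U ⟶ A ⨯ A whose image is the composite relation r ∘ s. -/
noncomputable def relCompMap {A R S : C} (r : R ⟶ A ⨯ A) (s : S ⟶ A ⨯ A) :
    relCompDom r s ⟶ A ⨯ A :=
  equalizer.ι _ _ ≫
    prod.lift ((prod.fst : R ⨯ S ⟶ R) ≫ r ≫ (prod.fst : A ⨯ A ⟶ A))
      ((prod.snd : R ⨯ S ⟶ S) ≫ s ≫ (prod.snd : A ⨯ A ⟶ A))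

/-- t : T ⟶ A ⨯ A is (an image factorisation of) the composite relation of r and s. -/
def IsRelComp {A R S T : C} (r : R ⟶ A ⨯ A) (s : S ⟶ A ⨯ A) (t : T ⟶ A ⨯ A) : Prop :=
  ∃ e : relCompDom r s ⟶ T, Nonempty (RegularEpi e) ∧ e ≫ t = relCompMap r s

/-- Two monomorphisms into X determine the same subobject. -/
def SameSub {X T W : C} (t : T ⟶ X) (w : W ⟶ X) : Prop :=
  (∃ u : T ⟶ W, u ≫ w = t) ∧ (∃ v : W ⟶ T, v ≫ t = w)

/-- A relation t on A is effective if it is, as a subobject of A ⨯ A, the kernel pair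
of some morphism. -/
def IsEffective {A T : C} (t : T ⟶ A ⨯ A) : Prop :=
  ∃ (B : C) (h : A ⟶ B), SameSub t (kerPairMap h)

/-- Two regular epimorphisms with domain A ker-commute: the composites
ker f ∘ ker g and ker g ∘ ker f coincide (as subobjects of A ⨯ A) and this composite
is an effective equivalence relation. -/
def KerCommute {A : C} (f g : RegEpiOver A) : Prop :=
  ∃ (T : C) (t : T ⟶ A ⨯ A), Mono t ∧
    IsRelComp (kerPairMap f.hom) (kerPairMap g.hom) t ∧
    IsRelComp (kerPairMap g.hom) (kerPairMap f.hom) t ∧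
    IsEffective t

variable {P : Type w} [CompleteLattice P]

/-- The presheaf γ_*H associated with a monotone map H : P^op → RegEpi(A): its
(uniquely determined) restriction maps, compatible with the quotient maps H(p). -/
structure GammaStar {A : C} (H : P → RegEpiOver A) where
  map : ∀ {p q : P}, p ≤ q → ((H q).cod ⟶ (H p).cod)
  fac : ∀ {p q : P} (h : p ≤ q), (H q).hom ≫ map h = (H p).hom

/-- H sends the supremum of S (an infimum in P^op) to an infimum of {H p | p ∈ S}
in the preorder RegEpi(A). -/
def PreservesInfOf {A : C} (H : P → RegEpiOver A) (S : Set P) : Prop :=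
  (∀ p ∈ S, (H (sSup S)).le (H p)) ∧
  ∀ t : RegEpiOver A, (∀ p ∈ S, t.le (H p)) → t.le (H (sSup S))

/-- H sends the infimum of S (a supremum in P^op) to a supremum of {H p | p ∈ S}
in the preorder RegEpi(A). -/
def PreservesSupOf {A : C} (H : P → RegEpiOver A) (S : Set P) : Prop :=
  (∀ p ∈ S, (H p).le (H (sInf S))) ∧
  ∀ t : RegEpiOver A, (∀ p ∈ S, (H p).le t) → (H (sInf S)).le t

/-- The elementwise statement that the cocone (γ_*H(p) → γ_*H(inf D))_{p ∈ D} is a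
colimit of the restriction of γ_*H to the codirected set D. -/
def GammaStar.IsColimitAtInf {A : C} {H : P → RegEpiOver A} (G : GammaStar H)
    (D : Set P) : Prop :=
  ∀ (B : C) (c : ∀ p ∈ D, (H p).cod ⟶ B),
    (∀ p q (hp : p ∈ D) (hq : q ∈ D) (hpq : p ≤ q), G.map hpq ≫ c p hp = c q hq) →
    ∃! u : (H (sInf D)).cod ⟶ B, ∀ p (hp : p ∈ D), G.map (sInf_le hp) ≫ u = c p hp

/-- γ_*H is a C-valued K-sheaf on the complete lattice P:
(K1) γ_*H(⊥) is subterminal; (K2) binary restriction squares are pullbacks;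
(K3) γ_*H sends codirected infima to (directed) colimits. -/
def GammaStar.IsKSheaf {A : C} {H : P → RegEpiOver A} (G : GammaStar H) : Prop :=
  Mono (terminal.from (H (⊥ : P)).cod) ∧
  (∀ p q : P, IsPullback (G.map (le_sup_left : p ≤ p ⊔ q))
    (G.map (le_sup_right : q ≤ p ⊔ q))
    (G.map (inf_le_left : p ⊓ q ≤ p)) (G.map (inf_le_right : p ⊓ q ≤ q))) ∧
  (∀ D : Set P, D.Nonempty → DirectedOn (· ≥ ·) D → G.IsColimitAtInf D)

attribute [local simp] prod.lift_fst prod.lift_snd prod.lift_fst_assoc prod.lift_snd_assoc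
  pullback.lift_fst pullback.lift_snd pullback.lift_fst_assoc pullback.lift_snd_assoc
  equalizer.lift_ι equalizer.lift_ι_assoc

omit [HasFiniteLimits C] in
theorem RegEpiOver.strongEpi_hom {A : C} (f : RegEpiOver A) : StrongEpi f.hom :=
  have : IsRegularEpi f.hom := ⟨f.regEpi⟩
  inferInstance

omit [HasFiniteLimits C] in
theorem RegEpiOver.exists_fac {A B : C} (f : RegEpiOver A) (k : A ⟶ B)
    (hk : ∀ {W : C} (x y : W ⟶ A), x ≫ f.hom = y ≫ f.hom → x ≫ k = y ≫ k) :
    ∃ l, f.hom ≫ l = k := by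
  obtain ⟨r⟩ := f.regEpi
  exact ⟨_, (Cofork.IsColimit.desc' r.isColimit k (hk _ _ r.w)).2⟩

theorem RegularCat.regularEpi_of_strongEpi [RegularCat C] {X Y : C} (f : X ⟶ Y) [StrongEpi f] :
    Nonempty (RegularEpi f) := by
  obtain ⟨Z, e, m, ⟨he⟩, hm, rfl⟩ := RegularCat.factor f
  have : StrongEpi m := strongEpi_of_strongEpi e m
  have : IsIso m := isIso_of_mono_of_strongEpi m
  exact ⟨he.ofArrowIso (Arrow.isoMk (f := Arrow.mk e) (g := Arrow.mk (e ≫ m)) (Iso.refl _) (asIso m)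
    (by simp))⟩

theorem RegularCat.strongEpi_pullback_snd [RegularCat C] {X Y Z : C} (f : X ⟶ Y) (g : Z ⟶ Y)
    [StrongEpi f] : StrongEpi (pullback.snd f g) :=
  have : IsRegularEpi (pullback.snd f g) :=
    ⟨RegularCat.stable f g (RegularCat.regularEpi_of_strongEpi f)⟩
  inferInstance

theorem kerPairMap_mono {A B : C} (f : A ⟶ B) : Mono (kerPairMap f) where
  right_cancellation x y h := by
    apply pullback.hom_ext
    · simpa [kerPairMap] using h =≫ prod.fst
    · simpa [kerPairMap] using h =≫ prod.snd

theorem exists_lift_relCompMap {A X Y W : C} (f : A ⟶ X) (g : A ⟶ Y) (a b c : W ⟶ A)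
    (hab : a ≫ f = b ≫ f) (hbc : b ≫ g = c ≫ g) :
    ∃ k, k ≫ relCompMap (kerPairMap f) (kerPairMap g) = prod.lift a c := by
  unfold relCompMap relCompDom
  refine ⟨equalizer.lift (prod.lift (pullback.lift a b hab) (pullback.lift b c hbc)) ?_, ?_⟩
  · simp [kerPairMap]
  · rw [equalizer.lift_ι_assoc]
    ext <;> simp [kerPairMap]

theorem exists_relCompMap_mid {A X Y : C} (f : A ⟶ X) (g : A ⟶ Y) :
    ∃ b, (relCompMap (kerPairMap f) (kerPairMap g) ≫ prod.fst) ≫ f = b ≫ f ∧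
      b ≫ g = (relCompMap (kerPairMap f) (kerPairMap g) ≫ prod.snd) ≫ g := by
  unfold relCompMap relCompDom
  refine ⟨equalizer.ι _ _ ≫ prod.fst ≫ kerPairMap f ≫ prod.snd, ?_, ?_⟩
  · simp [kerPairMap, pullback.condition]
  · rw [equalizer.condition]
    simp [kerPairMap, pullback.condition]

/-- If `A` covers the pullback of `a` and `b`, the kernel pairs of the two legs compose to the
kernel pair of the diagonal. -/
theorem isRelComp_kerPairMap_of_isPullback [RegularCat C] {A X Y Z Q : C} {s : A ⟶ Q}
    [StrongEpi s] {x : Q ⟶ X} {y : Q ⟶ Y} {a : X ⟶ Z} {b : Y ⟶ Z} (hQ : IsPullback x y a b)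
    {f : A ⟶ X} {g : A ⟶ Y} {h : A ⟶ Z} (hf : s ≫ x = f) (hg : s ≫ y = g)
    (ha : f ≫ a = h) (hb : g ≫ b = h) :
    IsRelComp (kerPairMap f) (kerPairMap g) (kerPairMap h) := by
  obtain ⟨d, hd₁, hd₂⟩ := exists_relCompMap_mid f g
  let e : relCompDom (kerPairMap f) (kerPairMap g) ⟶ pullback h h :=
    pullback.lift (relCompMap (kerPairMap f) (kerPairMap g) ≫ prod.fst)
      (relCompMap (kerPairMap f) (kerPairMap g) ≫ prod.snd) (by
        have h₁ := hd₁ =≫ a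
        have h₂ := hd₂ =≫ b
        simp only [Category.assoc, ha, hb] at h₁ h₂ ⊢
        rw [h₁, h₂])
  have he : e ≫ kerPairMap h = relCompMap (kerPairMap f) (kerPairMap g) := by
    ext <;> simp [kerPairMap, e]
  let q : pullback h h ⟶ Q := hQ.lift (pullback.fst h h ≫ f) (pullback.snd h h ≫ g)
    (by simp [ha, hb, pullback.condition])
  obtain ⟨k, hk⟩ := exists_lift_relCompMap f g (pullback.snd s q ≫ pullback.fst h h)
    (pullback.fst s q) (pullback.snd s q ≫ pullback.snd h h)
    (by rw [← hf, pullback.condition_assoc]; simp [q, hf])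
    (by rw [← hg, pullback.condition_assoc]; simp [q, hg])
  have hke : k ≫ e = pullback.snd s q := by
    have := kerPairMap_mono h
    rw [← cancel_mono (kerPairMap h), Category.assoc, he, hk]
    ext <;> simp [kerPairMap]
  have := RegularCat.strongEpi_pullback_snd s q
  rw [← hke] at this
  have := strongEpi_of_strongEpi k e
  exact ⟨e, RegularCat.regularEpi_of_strongEpi e, he⟩

/-- If the composite of the kernel pairs of `f` and `g` contains the kernel pair of their common
extension to `Z`, then `A` covers the pullback of `a` and `b`. -/
theorem strongEpi_pullback_lift_of_isRelComp [RegularCat C] {A X Y Z T : C} (f : A ⟶ X)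
    (g : A ⟶ Y) [StrongEpi f] [StrongEpi g] (a : X ⟶ Z) (b : Y ⟶ Z) (w : f ≫ a = g ≫ b)
    {t : T ⟶ A ⨯ A} (ht : IsRelComp (kerPairMap f) (kerPairMap g) t)
    (hT : ∀ {W : C} (c d : W ⟶ A), c ≫ f ≫ a = d ≫ f ≫ a → ∃ k, k ≫ t = prod.lift c d) :
    StrongEpi (pullback.lift f g w) := by
  obtain ⟨e, he, het⟩ := ht
  have : IsRegularEpi e := ⟨he⟩
  obtain ⟨d, hd₁, hd₂⟩ := exists_relCompMap_mid f g
  have wT : (t ≫ prod.fst) ≫ f ≫ a = (t ≫ prod.snd) ≫ g ≫ b := by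
    rw [← cancel_epi e]
    simp only [← Category.assoc, het]
    simp only [hd₁, ← hd₂]
    simp [w]
  let r : T ⟶ pullback a b := pullback.lift ((t ≫ prod.fst) ≫ f) ((t ≫ prod.snd) ≫ g)
    (by simpa using wT)
  let p₁ := pullback.snd f (pullback.fst a b)
  let p₂ := pullback.snd g (p₁ ≫ pullback.snd a b)
  have : StrongEpi p₁ := RegularCat.strongEpi_pullback_snd _ _
  have : StrongEpi p₂ := RegularCat.strongEpi_pullback_snd _ _
  have h₁ : (p₂ ≫ pullback.fst f (pullback.fst a b)) ≫ f = p₂ ≫ p₁ ≫ pullback.fst a b := by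
    rw [Category.assoc, pullback.condition]
  have h₂ : pullback.fst g (p₁ ≫ pullback.snd a b) ≫ g = p₂ ≫ p₁ ≫ pullback.snd a b :=
    pullback.condition
  obtain ⟨k, hk⟩ := hT (p₂ ≫ pullback.fst f (pullback.fst a b))
    (pullback.fst g (p₁ ≫ pullback.snd a b)) (by
      rw [← Category.assoc, h₁, w, ← Category.assoc _ g, h₂]
      simp only [Category.assoc, pullback.condition])
  have hkr : k ≫ r = p₂ ≫ p₁ := by
    apply pullback.hom_ext
    · simp only [r, Category.assoc, pullback.lift_fst, reassoc_of% hk, prod.lift_fst_assoc]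
      simpa using h₁
    · simp only [r, Category.assoc, pullback.lift_snd, reassoc_of% hk, prod.lift_snd_assoc]
      simpa using h₂
  have : StrongEpi (k ≫ r) := by rw [hkr]; infer_instance
  have : StrongEpi r := strongEpi_of_strongEpi k r
  have her : e ≫ r = d ≫ pullback.lift f g w := by
    apply pullback.hom_ext
    · simpa [r, reassoc_of% het] using hd₁
    · simpa [r, reassoc_of% het] using hd₂.symm
  have : StrongEpi (d ≫ pullback.lift f g w) := by rw [← her]; infer_instance
  exact strongEpi_of_strongEpi d _

/-- A pullback square of strong epimorphisms has the weak pushout property. -/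
theorem exists_fac_of_isPullback [RegularCat C] {A X Y Z Q B : C} {s : A ⟶ Q} [Epi s]
    {x : Q ⟶ X} {y : Q ⟶ Y} {a : X ⟶ Z} {b : Y ⟶ Z} (hQ : IsPullback x y a b)
    [StrongEpi a] [StrongEpi b] (i : X ⟶ B) (j : Y ⟶ B) (hij : s ≫ x ≫ i = s ≫ y ≫ j) :
    ∃ l, a ≫ l = i := by
  refine RegEpiOver.exists_fac ⟨Z, a, RegularCat.regularEpi_of_strongEpi a⟩ i fun c d hcd => ?_
  replace hij := (cancel_epi s).1 hij
  dsimp only at hcd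
  have : StrongEpi (pullback.snd b (c ≫ a)) := RegularCat.strongEpi_pullback_snd _ _
  rw [← cancel_epi (pullback.snd b (c ≫ a))]
  have key : ∀ c' : _ ⟶ X, c' ≫ a = c ≫ a →
      pullback.snd b (c ≫ a) ≫ c' ≫ i = pullback.fst b (c ≫ a) ≫ j := by
    intro c' hc'
    have h : (pullback.snd b (c ≫ a) ≫ c') ≫ a = pullback.fst b (c ≫ a) ≫ b := by
      rw [Category.assoc, hc', pullback.condition]
    have h₁ := hQ.lift_fst _ _ h
    have h₂ := hQ.lift_snd _ _ h
    rw [← Category.assoc, ← h₁, Category.assoc, hij, reassoc_of% h₂]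
  rw [key c rfl, key d hcd.symm]

theorem PreservesSupOf.exists_fac [RegularCat C] {A B : C} {H : P → RegEpiOver A} {S : Set P}
    (hS : PreservesSupOf H S) (k : A ⟶ B) (hk : ∀ p ∈ S, ∃ l, (H p).hom ≫ l = k) :
    ∃ l, (H (sInf S)).hom ≫ l = k := by
  obtain ⟨Z, e, m, he, hm, rfl⟩ := RegularCat.factor k
  obtain ⟨l, hl⟩ := hS.2 ⟨Z, e, he⟩ fun p hp => by
    obtain ⟨l, hl⟩ := hk p hp
    refine (H p).exists_fac e fun x y hxy => ?_
    rw [← cancel_mono m, Category.assoc, Category.assoc, ← hl, reassoc_of% hxy]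
  exact ⟨l ≫ m, by rw [reassoc_of% hl]⟩

omit [HasFiniteLimits C] in
theorem GammaStar.strongEpi_map {A : C} {H : P → RegEpiOver A} (G : GammaStar H) {p q : P}
    (h : p ≤ q) : StrongEpi (G.map h) := by
  have := (H p).strongEpi_hom
  rw [← G.fac h] at this
  exact strongEpi_of_strongEpi (H q).hom _

omit [HasFiniteLimits C] in
theorem isIso_hom_top_of_preservesSupOf {A : C} {H : P → RegEpiOver A}
    (h : PreservesSupOf H ∅) : IsIso (H (⊤ : P)).hom := by
  rw [← sInf_empty]
  have := (H (sInf ∅)).strongEpi_hom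
  obtain ⟨l, hl⟩ := h.2 ⟨A, 𝟙 A, ⟨RegularEpi.ofIso (Iso.refl A)⟩⟩ (by simp)
  have : Mono ((H (sInf ∅)).hom ≫ l) := by rw [hl]; infer_instance
  have := mono_of_mono (H (sInf ∅)).hom l
  exact isIso_of_mono_of_strongEpi _

theorem mono_terminal_from_bot_of_preservesInfOf [RegularCat C] {A : C} {H : P → RegEpiOver A}
    (h : PreservesInfOf H ∅) : Mono (terminal.from (H (⊥ : P)).cod) := by
  rw [← sSup_empty]
  have := (H (sSup ∅)).strongEpi_hom
  obtain ⟨Z, e, m, he, hm, -⟩ := RegularCat.factor (terminal.from A)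
  have hZ : ∀ {W : C} (x y : W ⟶ Z), x = y := fun x y => by
    rw [← cancel_mono m]; exact Subsingleton.elim _ _
  obtain ⟨l, hl⟩ := h.2 ⟨Z, e, he⟩ (by simp)
  obtain ⟨k, hk⟩ := (H (sSup ∅)).exists_fac e fun x y _ => hZ _ _
  have hkl : k ≫ l = 𝟙 _ := by
    rw [← cancel_epi (H (sSup ∅)).hom, reassoc_of% hk, Category.comp_id]
    exact hl
  refine ⟨fun x y _ => ?_⟩
  rw [← Category.comp_id x, ← Category.comp_id y, ← hkl, ← Category.assoc, ← Category.assoc,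
    hZ (x ≫ k) (y ≫ k)]

theorem GammaStar.isPullback_of_kerCommute [RegularCat C] {A : C} {H : P → RegEpiOver A}
    (G : GammaStar H) {p q : P} (hinf : PreservesInfOf H {p, q}) (hsup : PreservesSupOf H {p, q})
    (hk : KerCommute (H p) (H q)) :
    IsPullback (G.map (le_sup_left : p ≤ p ⊔ q)) (G.map (le_sup_right : q ≤ p ⊔ q))
      (G.map (inf_le_left : p ⊓ q ≤ p)) (G.map (inf_le_right : p ⊓ q ≤ q)) := by
  have := (H p).strongEpi_hom
  have := (H q).strongEpi_hom
  have := (H (p ⊔ q)).strongEpi_hom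
  obtain ⟨T, t, ht, hpq, -, B, h, ⟨u, hu⟩, ⟨v, hv⟩⟩ := hk
  have hth : (t ≫ prod.fst) ≫ h = (t ≫ prod.snd) ≫ h := by
    simp [← hu, kerPairMap, pullback.condition]
  have ⟨e, _, het⟩ := hpq
  have hcomp : ∀ {W : C} (a b c : W ⟶ A), a ≫ (H p).hom = b ≫ (H p).hom →
      b ≫ (H q).hom = c ≫ (H q).hom → a ≫ h = c ≫ h := by
    intro W a b c hab hbc
    obtain ⟨k, hk⟩ := exists_lift_relCompMap _ _ a b c hab hbc
    rw [← het] at hk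
    simpa [reassoc_of% hk] using (k ≫ e) ≫= hth
  have hl : ∃ l, (H (p ⊓ q)).hom ≫ l = h := by
    rw [← sInf_pair]
    apply hsup.exists_fac h
    rintro r (rfl | rfl)
    · exact (H r).exists_fac h fun x y hxy => hcomp x y y hxy rfl
    · exact (H r).exists_fac h fun x y hxy => hcomp x x y rfl hxy
  obtain ⟨l, hl⟩ := hl
  have w : (H p).hom ≫ G.map (inf_le_left : p ⊓ q ≤ p) =
      (H q).hom ≫ G.map (inf_le_right : p ⊓ q ≤ q) := by rw [G.fac, G.fac]
  have := strongEpi_pullback_lift_of_isRelComp _ _ _ _ w hpq (by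
    intro W c d hcd
    rw [G.fac] at hcd
    refine ⟨pullback.lift c d (by rw [← hl, reassoc_of% hcd]) ≫ v, ?_⟩
    rw [Category.assoc, hv]
    ext <;> simp [kerPairMap])
  have hle : RegEpiOver.le ⟨_, pullback.lift _ _ w, RegularCat.regularEpi_of_strongEpi _⟩
      (H (p ⊔ q)) := by
    rw [← sSup_pair]
    apply hinf.2
    rintro r (rfl | rfl)
    · exact ⟨pullback.fst _ _, by simp⟩
    · exact ⟨pullback.snd _ _, by simp⟩
  obtain ⟨k, hk⟩ := hle
  dsimp only at k hk
  have hk₁ : k ≫ G.map le_sup_left = pullback.fst _ _ := by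
    rw [← cancel_epi (pullback.lift _ _ w), reassoc_of% hk, G.fac, pullback.lift_fst]
  have hk₂ : k ≫ G.map le_sup_right = pullback.snd _ _ := by
    rw [← cancel_epi (pullback.lift _ _ w), reassoc_of% hk, G.fac, pullback.lift_snd]
  have w' : G.map (le_sup_left : p ≤ p ⊔ q) ≫ G.map (inf_le_left : p ⊓ q ≤ p) =
      G.map (le_sup_right : q ≤ p ⊔ q) ≫ G.map (inf_le_right : p ⊓ q ≤ q) := by
    rw [← cancel_epi (H (p ⊔ q)).hom, reassoc_of% G.fac, reassoc_of% G.fac, w]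
  refine IsPullback.of_iso_pullback ⟨w'⟩ ⟨pullback.lift _ _ w', k, ?_, ?_⟩ ?_ ?_
  · have hlk : (H (p ⊔ q)).hom ≫ pullback.lift _ _ w' = pullback.lift _ _ w := by
      apply pullback.hom_ext <;> simp [G.fac]
    rw [← cancel_epi (H (p ⊔ q)).hom, reassoc_of% hlk, hk, Category.comp_id]
  · apply pullback.hom_ext <;> simp [hk₁, hk₂]
  · simp
  · simp

theorem GammaStar.isColimitAtInf_of_preservesSupOf [RegularCat C] {A : C} {H : P → RegEpiOver A}
    (G : GammaStar H) {D : Set P} (hne : D.Nonempty) (hD : DirectedOn (· ≥ ·) D)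
    (hsup : PreservesSupOf H D) : G.IsColimitAtInf D := by
  intro B c hc
  have hepi : ∀ p, Epi (H p).hom := fun p => (H p).strongEpi_hom.epi
  obtain ⟨p₀, hp₀⟩ := hne
  have heq : ∀ p (hp : p ∈ D) q (hq : q ∈ D), (H p).hom ≫ c p hp = (H q).hom ≫ c q hq := by
    intro p hp q hq
    obtain ⟨r, hr, hpr, hqr⟩ := hD p hp q hq
    rw [← hc r p hr hp hpr, ← hc r q hr hq hqr, reassoc_of% G.fac, reassoc_of% G.fac]
  obtain ⟨u, hu⟩ := hsup.exists_fac ((H p₀).hom ≫ c p₀ hp₀) fun p hp => ⟨c p hp, heq _ _ _ _⟩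
  refine ⟨u, fun p hp => ?_, fun u' hu' => ?_⟩
  · rw [← cancel_epi (H p).hom, reassoc_of% G.fac, hu, heq]
  · rw [← cancel_epi (H (sInf D)).hom, hu, ← hu' p₀ hp₀, reassoc_of% G.fac]

theorem GammaStar.IsKSheaf.preservesInfOf {A : C} {H : P → RegEpiOver A} {G : GammaStar H}
    (hG : G.IsKSheaf) {S : Set P} (hS : S.Finite) : PreservesInfOf H S := by
  refine ⟨fun p hp => ⟨_, G.fac (le_sSup hp)⟩, fun t => ?_⟩
  induction S, hS using Set.Finite.induction_on with
  | empty =>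
    intro _
    have := hG.1
    rw [sSup_empty]
    refine t.exists_fac _ fun x y _ => ?_
    rw [← cancel_mono (terminal.from (H ⊥).cod)]
    exact Subsingleton.elim _ _
  | @insert p S _ _ ih =>
    intro ht
    obtain ⟨i, hi⟩ := ht p (by simp)
    obtain ⟨j, hj⟩ := ih fun q hq => ht q (by simp [hq])
    have hepi := t.strongEpi_hom
    have hQ := hG.2.1 p (sSup S)
    rw [sSup_insert]
    have w : i ≫ G.map inf_le_left = j ≫ G.map (inf_le_right : p ⊓ sSup S ≤ sSup S) := by
      rw [← cancel_epi t.hom, reassoc_of% hi, reassoc_of% hj, G.fac, G.fac]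
    refine ⟨hQ.lift i j w, hQ.hom_ext ?_ ?_⟩
    · simp [hi, G.fac]
    · simp [hj, G.fac]

theorem GammaStar.IsKSheaf.le_inf [RegularCat C] {A : C} {H : P → RegEpiOver A}
    {G : GammaStar H} (hG : G.IsKSheaf) {p q : P} {t : RegEpiOver A} (hp : (H p).le t)
    (hq : (H q).le t) : (H (p ⊓ q)).le t := by
  obtain ⟨i, hi⟩ := hp
  obtain ⟨j, hj⟩ := hq
  have := (H (p ⊔ q)).strongEpi_hom
  have := G.strongEpi_map (inf_le_left : p ⊓ q ≤ p)
  have := G.strongEpi_map (inf_le_right : p ⊓ q ≤ q)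
  obtain ⟨l, hl⟩ := exists_fac_of_isPullback (s := (H (p ⊔ q)).hom) (hG.2.1 p q) i j
    (by rw [reassoc_of% G.fac, reassoc_of% G.fac, hi, hj])
  exact ⟨l, by rw [← hi, ← hl, reassoc_of% G.fac]⟩

theorem GammaStar.IsKSheaf.preservesSupOf [RegularCat C] {A : C} {H : P → RegEpiOver A}
    {G : GammaStar H} (hG : G.IsKSheaf) [IsIso (H (⊤ : P)).hom] (S : Set P) :
    PreservesSupOf H S := by
  refine ⟨fun p hp => ⟨_, G.fac (sInf_le hp)⟩, fun t ht => ?_⟩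
  let D : Set P := {p | ∃ F : Set P, F.Finite ∧ F ⊆ S ∧ sInf F = p}
  have hDt : ∀ p ∈ D, (H p).le t := by
    rintro _ ⟨F, hF, hFS, rfl⟩
    induction F, hF using Set.Finite.induction_on with
    | empty =>
      rw [sInf_empty]
      exact ⟨inv (H ⊤).hom ≫ t.hom, by simp⟩
    | @insert p F _ _ ih =>
      rw [sInf_insert]
      exact hG.le_inf (ht p (hFS (by simp))) (ih fun x hx => hFS (by simp [hx]))
  have hD : sInf D = sInf S := by
    apply le_antisymm
    · exact le_sInf fun p hp => sInf_le ⟨{p}, by simp, by simpa using hp, by simp⟩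
    · refine le_sInf ?_
      rintro _ ⟨F, -, hFS, rfl⟩
      exact sInf_le_sInf hFS
  choose c hc using hDt
  obtain ⟨u, hu, -⟩ := hG.2.2 D ⟨⊤, ∅, by simp, by simp, by simp⟩ (by
    rintro _ ⟨F, hF, hFS, rfl⟩ _ ⟨F', hF', hFS', rfl⟩
    exact ⟨_, ⟨F ∪ F', hF.union hF', Set.union_subset hFS hFS', rfl⟩,
      sInf_le_sInf Set.subset_union_left, sInf_le_sInf Set.subset_union_right⟩) t.cod c (by
    intro p q hp hq hpq
    have := (H q).strongEpi_hom
    rw [← cancel_epi (H q).hom, reassoc_of% G.fac, hc, hc])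
  rw [← hD]
  have hT : (⊤ : P) ∈ D := ⟨∅, by simp, by simp, by simp⟩
  exact ⟨u, by rw [← hc ⊤ hT, ← hu ⊤ hT, reassoc_of% G.fac]⟩

theorem GammaStar.IsKSheaf.kerCommute [RegularCat C] {A : C} {H : P → RegEpiOver A}
    {G : GammaStar H} (hG : G.IsKSheaf) (p q : P) : KerCommute (H p) (H q) := by
  have := (H (p ⊔ q)).strongEpi_hom
  have hQ := hG.2.1 p q
  exact ⟨_, kerPairMap (H (p ⊓ q)).hom, kerPairMap_mono _,
    isRelComp_kerPairMap_of_isPullback (s := (H (p ⊔ q)).hom) hQ (G.fac _) (G.fac _) (G.fac _)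
      (G.fac _),
    isRelComp_kerPairMap_of_isPullback (s := (H (p ⊔ q)).hom) hQ.flip (G.fac _) (G.fac _)
      (G.fac _) (G.fac _),
    _, _, ⟨𝟙 _, by simp⟩, ⟨𝟙 _, by simp⟩⟩

theorem statement6 [RegularCat C] {A : C}
    (H : P → RegEpiOver A) (hH : ∀ {p q : P}, p ≤ q → (H q).le (H p))
    (G : GammaStar H) :
    -- (1): H preserves finite infima and arbitrary suprema, and its image consists of
    -- pairwise ker-commuting elements
    ((∀ S : Set P, S.Finite → PreservesInfOf H S) ∧
     (∀ S : Set P, PreservesSupOf H S) ∧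
     (∀ p q : P, KerCommute (H p) (H q))) ↔
    -- (2): γ_*H is a C-valued K-sheaf on P and H(⊤) is an isomorphism in C
    (G.IsKSheaf ∧ IsIso (H (⊤ : P)).hom) := by
  constructor
  · rintro ⟨hinf, hsup, hk⟩
    exact ⟨⟨mono_terminal_from_bot_of_preservesInfOf (hinf ∅ Set.finite_empty),
      fun p q => G.isPullback_of_kerCommute (hinf _ (by simp)) (hsup _) (hk p q),
      fun D hne hD => G.isColimitAtInf_of_preservesSupOf hne hD (hsup D)⟩,
      isIso_hom_top_of_preservesSupOf (hsup ∅)⟩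
  · rintro ⟨hG, hT⟩
    exact ⟨fun S hS => hG.preservesInfOf hS, hG.preservesSupOf, hG.kerCommute⟩
end

section
/- Let C be a regular category, A an object of C, P a complete lattice, and (F, φ) a soft K-sheaf representation of A over P. Define the monotone map H_F : P^op → RegEpi(A) by H_F(p) = (F(⊤) → F(p)) ∘ φ (the restriction map composed with φ). Then: (a) γ_*H_F = F; (b) H_F preserves finite infima and arbitrary suprema, and any two regular epimorphisms in its image ker-commute. -/
open CategoryTheory CategoryTheory.Limits

universe w v u

variable {C : Type u} [Category.{v} C]

variable [HasFiniteLimits C]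

variable {P : Type w} [CompleteLattice P]

open Opposite

/-- Restriction map of a presheaf on a complete lattice. -/
def res (F : Pᵒᵖ ⥤ C) {p q : P} (h : p ≤ q) : F.obj (op q) ⟶ F.obj (op p) :=
  F.map (homOfLE h).op

/-- The elementwise statement that the cocone (F(p) → F(inf D))_{p ∈ D} is a colimit of
the restriction of F to the codirected set D. -/
def IsColimitAtInf (F : Pᵒᵖ ⥤ C) (D : Set P) : Prop :=
  ∀ (B : C) (c : ∀ p ∈ D, F.obj (op p) ⟶ B),
    (∀ p q (hp : p ∈ D) (hq : q ∈ D) (hpq : p ≤ q), res F hpq ≫ c p hp = c q hq) →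
    ∃! u : F.obj (op (sInf D)) ⟶ B, ∀ p (hp : p ∈ D), res F (sInf_le hp) ≫ u = c p hp

variable [HasFiniteLimits C]

/-- F : P^op → C is a C-valued K-sheaf on the complete lattice P. -/
def IsKSheaf (F : Pᵒᵖ ⥤ C) : Prop :=
  Mono (terminal.from (F.obj (op (⊥ : P)))) ∧
  (∀ p q : P, IsPullback (res F (le_sup_left : p ≤ p ⊔ q))
    (res F (le_sup_right : q ≤ p ⊔ q))
    (res F (inf_le_left : p ⊓ q ≤ p)) (res F (inf_le_right : p ⊓ q ≤ q))) ∧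
  (∀ D : Set P, D.Nonempty → DirectedOn (· ≥ ·) D → IsColimitAtInf F D)

/-- Softness of a presheaf on a complete lattice: every restriction map
F(⊤) → F(p) is a regular epimorphism. -/
def IsSoft (F : Pᵒᵖ ⥤ C) : Prop :=
  ∀ p : P, Nonempty (RegularEpi (res F (le_top : p ≤ ⊤)))

variable (C P) in
/-- A K-sheaf representation of A over P: a K-sheaf F together with an isomorphism
φ : A → F(⊤). -/
structure KShr (A : C) : Type (max u v w) where
  F : Pᵒᵖ ⥤ C
  ksheaf : IsKSheaf F
  φ : A ⟶ F.obj (op (⊤ : P))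
  iso : IsIso φ

/-- Morphisms of K-sheaf representations: natural transformations α with α_⊤ ∘ φ = ψ. -/
instance {A : C} : Category (KShr C P A) where
  Hom X Y := {α : X.F ⟶ Y.F // X.φ ≫ α.app (op (⊤ : P)) = Y.φ}
  id X := ⟨𝟙 X.F, by simp⟩
  comp f g := ⟨f.1 ≫ g.1, by rw [NatTrans.comp_app, ← Category.assoc, f.2, g.2]⟩
  id_comp f := Subtype.ext (by simp)
  comp_id f := Subtype.ext (by simp)
  assoc f g h := Subtype.ext (by simp)

section RegularCategory

variable {D : Type u} [Category.{v} D]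

lemma isRegularEpi_iff_nonempty {X Y : D} (f : X ⟶ Y) :
    IsRegularEpi f ↔ Nonempty (RegularEpi f) :=
  ⟨fun h => h.1, fun h => ⟨h⟩⟩

lemma isRegularEpi_isIso_comp {X Y Z : D} (f : X ⟶ Y) [IsIso f] (g : Y ⟶ Z)
    [hg : IsRegularEpi g] : IsRegularEpi (f ≫ g) :=
  ((MorphismProperty.regularEpi D).cancel_left_of_respectsIso f g).2 hg

/-- Morphisms out of the codomain of a regular epimorphism are given by morphisms out of its
domain which coequalise every pair that it coequalises. -/
lemma CategoryTheory.IsRegularEpi.exists_desc {X Y Z : D} (f : X ⟶ Y) [IsRegularEpi f] (k : X ⟶ Z)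
    (h : ∀ (T : D) (a b : T ⟶ X), a ≫ f = b ≫ f → a ≫ k = b ≫ k) : ∃ l : Y ⟶ Z, f ≫ l = k :=
  ⟨IsRegularEpi.desc f k (h _ _ _ (IsRegularEpi.w f)), IsRegularEpi.fac f k _⟩

variable [HasFiniteLimits D]

lemma isRegularEpi_pullback_snd [RegularCat D] {X Y Z : D} (f : X ⟶ Y) (g : Z ⟶ Y)
    [hf : IsRegularEpi f] :
    IsRegularEpi (pullback.snd f g) :=
  ⟨RegularCat.stable f g hf.1⟩

lemma isRegularEpi_of_comp [RegularCat D] {X Y Z : D} (f : X ⟶ Y) (g : Y ⟶ Z)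
    [IsRegularEpi (f ≫ g)] :
    IsRegularEpi g := by
  obtain ⟨W, e, m, he, hm, rfl⟩ := RegularCat.factor g
  have he : IsRegularEpi e := ⟨he⟩
  have : StrongEpi ((f ≫ e) ≫ m) := by
    rw [Category.assoc]
    infer_instance
  have : StrongEpi m := strongEpi_of_strongEpi (f ≫ e) m
  have : IsIso m := isIso_of_mono_of_strongEpi m
  exact ((MorphismProperty.regularEpi D).cancel_right_of_respectsIso e m).2 he

/-- In a regular category, a pullback square of regular epimorphisms is a (weak) pushout. -/
lemma CategoryTheory.IsPullback.exists_desc [RegularCat D] {W X Y Z : D} {a : W ⟶ X}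
    {b : W ⟶ Y} {f : X ⟶ Z} {g : Y ⟶ Z}
    (sq : IsPullback a b f g) [IsRegularEpi f] [IsRegularEpi g] {B : D} (k : X ⟶ B) (l : Y ⟶ B)
    (h : a ≫ k = b ≫ l) : ∃ m : Z ⟶ B, f ≫ m = k := by
  refine IsRegularEpi.exists_desc f k fun T s t hst => ?_
  have := isRegularEpi_pullback_snd g (s ≫ f)
  have hs : pullback.snd g (s ≫ f) ≫ s ≫ k = pullback.fst g (s ≫ f) ≫ l := by
    have := sq.lift_fst (pullback.snd g (s ≫ f) ≫ s) (pullback.fst g (s ≫ f))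
      (by rw [pullback.condition, Category.assoc])
    rw [← Category.assoc, ← this, Category.assoc, h, sq.lift_snd_assoc]
  have ht : pullback.snd g (s ≫ f) ≫ t ≫ k = pullback.fst g (s ≫ f) ≫ l := by
    have := sq.lift_fst (pullback.snd g (s ≫ f) ≫ t) (pullback.fst g (s ≫ f))
      (by rw [Category.assoc, ← hst, pullback.condition])
    rw [← Category.assoc, ← this, Category.assoc, h, sq.lift_snd_assoc]
  rw [← cancel_epi (pullback.snd g (s ≫ f)), hs, ht]

@[simp]
lemma kerPairMap_fst {A B : D} (f : A ⟶ B) : kerPairMap f ≫ prod.fst = pullback.fst f f :=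
  prod.lift_fst _ _

@[simp]
lemma kerPairMap_snd {A B : D} (f : A ⟶ B) : kerPairMap f ≫ prod.snd = pullback.snd f f :=
  prod.lift_snd _ _

instance mono_kerPairMap {A B : D} (f : A ⟶ B) : Mono (kerPairMap f) where
  right_cancellation s t h := by
    apply pullback.hom_ext
    · simpa using h =≫ prod.fst
    · simpa using h =≫ prod.snd

/-- The inclusion of the domain of the composite of two relations into their product. -/
noncomputable def relCompι {A R S : D} (r : R ⟶ A ⨯ A) (s : S ⟶ A ⨯ A) :
    relCompDom r s ⟶ R ⨯ S :=
  equalizer.ι _ _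

lemma relCompι_condition {A R S : D} (r : R ⟶ A ⨯ A) (s : S ⟶ A ⨯ A) :
    relCompι r s ≫ prod.fst ≫ r ≫ prod.snd = relCompι r s ≫ prod.snd ≫ s ≫ prod.fst :=
  equalizer.condition _ _

lemma exists_comp_relCompι {A R S T : D} {r : R ⟶ A ⨯ A} {s : S ⟶ A ⨯ A} (a : T ⟶ R)
    (b : T ⟶ S) (h : a ≫ r ≫ prod.snd = b ≫ s ≫ prod.fst) :
    ∃ d : T ⟶ relCompDom r s, d ≫ relCompι r s = prod.lift a b :=
  ⟨equalizer.lift (prod.lift a b) (by rwa [prod.lift_fst_assoc, prod.lift_snd_assoc]),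
    equalizer.lift_ι _ _⟩

lemma relCompMap_fst {A R S : D} (r : R ⟶ A ⨯ A) (s : S ⟶ A ⨯ A) :
    relCompMap r s ≫ prod.fst = relCompι r s ≫ prod.fst ≫ r ≫ prod.fst :=
  (Category.assoc _ _ _).trans (congrArg (relCompι r s ≫ ·) (prod.lift_fst _ _))

lemma relCompMap_snd {A R S : D} (r : R ⟶ A ⨯ A) (s : S ⟶ A ⨯ A) :
    relCompMap r s ≫ prod.snd = relCompι r s ≫ prod.snd ≫ s ≫ prod.snd :=
  (Category.assoc _ _ _).trans (congrArg (relCompι r s ≫ ·) (prod.lift_snd _ _))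

/-- If `h : A ⟶ W` is a regular epimorphism onto the pullback of `f` and `g`, then the composite
of the kernel pairs of `h ≫ a` and `h ≫ b` is the kernel pair of `h ≫ a ≫ f`. -/
lemma CategoryTheory.IsPullback.isRelComp_kerPairMap [RegularCat D] {A W X Y Z : D} {a : W ⟶ X}
    {b : W ⟶ Y} {f : X ⟶ Z} {g : Y ⟶ Z} (sq : IsPullback a b f g) (h : A ⟶ W) [IsRegularEpi h]
    {x : A ⟶ X} {y : A ⟶ Y} {z : A ⟶ Z} (hx : h ≫ a = x) (hy : h ≫ b = y) (hxz : x ≫ f = z)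
    (hyz : y ≫ g = z) : IsRelComp (kerPairMap x) (kerPairMap y) (kerPairMap z) := by
  let ι := relCompι (kerPairMap x) (kerPairMap y)
  have hι : ι ≫ prod.fst ≫ pullback.snd x x = ι ≫ prod.snd ≫ pullback.fst y y := by
    simpa using relCompι_condition (kerPairMap x) (kerPairMap y)
  have he : (ι ≫ prod.fst ≫ pullback.fst x x) ≫ z = (ι ≫ prod.snd ≫ pullback.snd y y) ≫ z := by
    calc (ι ≫ prod.fst ≫ pullback.fst x x) ≫ z
        = ι ≫ prod.fst ≫ (pullback.fst x x ≫ x) ≫ f := by simp [← hxz]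
      _ = (ι ≫ prod.fst ≫ pullback.snd x x) ≫ x ≫ f := by rw [pullback.condition]; simp
      _ = ι ≫ prod.snd ≫ (pullback.fst y y ≫ y) ≫ g := by rw [hι, hxz, ← hyz]; simp
      _ = (ι ≫ prod.snd ≫ pullback.snd y y) ≫ z := by rw [pullback.condition, ← hyz]; simp
  let e : relCompDom (kerPairMap x) (kerPairMap y) ⟶ pullback z z := pullback.lift _ _ he
  have he_fst : e ≫ pullback.fst z z = ι ≫ prod.fst ≫ pullback.fst x x := pullback.lift_fst _ _ _
  have he_snd : e ≫ pullback.snd z z = ι ≫ prod.snd ≫ pullback.snd y y := pullback.lift_snd _ _ _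
  refine ⟨e, (isRegularEpi_iff_nonempty _).1 ?_, prod.hom_ext ?_ ?_⟩
  rotate_left
  · rw [Category.assoc, kerPairMap_fst, he_fst, relCompMap_fst, kerPairMap_fst]
  · rw [Category.assoc, kerPairMap_snd, he_snd, relCompMap_snd, kerPairMap_snd]
  let c : pullback z z ⟶ W := sq.lift (pullback.fst z z ≫ x) (pullback.snd z z ≫ y) (by
    rw [Category.assoc, Category.assoc, hxz, hyz, pullback.condition])
  let m := pullback.fst h c
  let n := pullback.snd h c
  have hm : m ≫ h = n ≫ c := pullback.condition
  have hmx : (n ≫ pullback.fst z z) ≫ x = m ≫ x := by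
    rw [← hx, reassoc_of% hm, sq.lift_fst, hx, Category.assoc]
  have hmy : m ≫ y = (n ≫ pullback.snd z z) ≫ y := by
    rw [← hy, reassoc_of% hm, sq.lift_snd, hy, Category.assoc]
  obtain ⟨d, hd⟩ := exists_comp_relCompι (r := kerPairMap x) (s := kerPairMap y)
    (pullback.lift _ _ hmx) (pullback.lift _ _ hmy)
    (by rw [kerPairMap_fst, kerPairMap_snd, pullback.lift_fst, pullback.lift_snd])
  have hde : d ≫ e = n := by
    apply pullback.hom_ext
    · rw [Category.assoc, he_fst, reassoc_of% hd, prod.lift_fst_assoc, pullback.lift_fst]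
    · rw [Category.assoc, he_snd, reassoc_of% hd, prod.lift_snd_assoc, pullback.lift_snd]
  have : IsRegularEpi (d ≫ e) := hde ▸ isRegularEpi_pullback_snd h c
  exact isRegularEpi_of_comp d e

end RegularCategory

section Restriction

variable {D : Type u} [Category.{v} D] {Q : Type w} [CompleteLattice Q] (F : Qᵒᵖ ⥤ D)

@[simp]
lemma res_comp_res {p q r : Q} (h : p ≤ q) (h' : q ≤ r) :
    res F h' ≫ res F h = res F (h.trans h') := by
  rw [res, res, ← F.map_comp]
  rfl

@[simp]
lemma res_self (p : Q) : res F (le_refl p) = 𝟙 _ :=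
  F.map_id _

end Restriction

section Representation

variable {D : Type u} [Category.{v} D] {Q : Type w} [CompleteLattice Q] {F : Qᵒᵖ ⥤ D} {A : D}

/-- The composite of `φ : A ⟶ F(⊤)` with the restriction map `F(⊤) ⟶ F(p)`. -/
def toSection (φ : A ⟶ F.obj (op ⊤)) (p : Q) : A ⟶ F.obj (op p) :=
  φ ≫ res F le_top

@[simp]
lemma toSection_comp_res (φ : A ⟶ F.obj (op ⊤)) {p q : Q} (h : p ≤ q) :
    toSection φ q ≫ res F h = toSection φ p := by
  simp [toSection]

instance (t : RegEpiOver A) : IsRegularEpi t.hom := ⟨t.regEpi⟩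

lemma IsSoft.isRegularEpi_toSection (hsoft : IsSoft F) (φ : A ⟶ F.obj (op ⊤)) [IsIso φ] (p : Q) :
    IsRegularEpi (toSection φ p) :=
  have : IsRegularEpi (res F (le_top : p ≤ ⊤)) := ⟨hsoft p⟩
  isRegularEpi_isIso_comp φ (res F le_top)

lemma IsSoft.isRegularEpi_res [HasFiniteLimits D] [RegularCat D] (hsoft : IsSoft F) {p q : Q}
    (h : p ≤ q) : IsRegularEpi (res F h) := by
  have : IsRegularEpi (res F (le_top : q ≤ ⊤) ≫ res F h) := by
    rw [res_comp_res]
    exact ⟨hsoft p⟩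
  exact isRegularEpi_of_comp (res F le_top) (res F h)

/-- The map `p ↦ (A ≅ F(⊤) → F(p))` from a lattice to the regular epimorphisms with domain `A`
induced by a soft presheaf `F` and an isomorphism `A ≅ F(⊤)`. -/
def softQuotient (hsoft : IsSoft F) (φ : A ⟶ F.obj (op ⊤)) [IsIso φ] (p : Q) : RegEpiOver A where
  cod := F.obj (op p)
  hom := toSection φ p
  regEpi := (hsoft.isRegularEpi_toSection φ p).1

variable (hsoft : IsSoft F) (φ : A ⟶ F.obj (op ⊤)) [IsIso φ]

lemma le_softQuotient_iff {t : RegEpiOver A} {p : Q} : t.le (softQuotient hsoft φ p) ↔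
    ∃ k : t.cod ⟶ F.obj (op p), t.hom ≫ k = toSection φ p :=
  Iff.rfl

lemma softQuotient_le_iff {t : RegEpiOver A} {p : Q} : (softQuotient hsoft φ p).le t ↔
    ∃ k : F.obj (op p) ⟶ t.cod, toSection φ p ≫ k = t.hom :=
  Iff.rfl

lemma softQuotient_le {p q : Q} (h : p ≤ q) :
    (softQuotient hsoft φ q).le (softQuotient hsoft φ p) :=
  ⟨res F h, toSection_comp_res φ h⟩

lemma softQuotient_top_le (t : RegEpiOver A) : (softQuotient hsoft φ ⊤).le t :=
  (softQuotient_le_iff hsoft φ).2 ⟨inv φ ≫ t.hom, by simp [toSection]⟩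

variable [HasFiniteLimits D]

lemma le_softQuotient_bot (hks : IsKSheaf F) (t : RegEpiOver A) :
    t.le (softQuotient hsoft φ ⊥) := by
  have := hks.1
  exact IsRegularEpi.exists_desc t.hom (toSection φ ⊥) fun T a b _ =>
    (cancel_mono (terminal.from (F.obj (op (⊥ : Q))))).1 (Subsingleton.elim _ _)

lemma le_softQuotient_sup (hks : IsKSheaf F) {t : RegEpiOver A} {p q : Q}
    (hp : t.le (softQuotient hsoft φ p)) (hq : t.le (softQuotient hsoft φ q)) :
    t.le (softQuotient hsoft φ (p ⊔ q)) := by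
  rw [le_softQuotient_iff] at hp hq ⊢
  obtain ⟨k, hk⟩ := hp
  obtain ⟨l, hl⟩ := hq
  have sq := hks.2.1 p q
  have hkl : k ≫ res F (inf_le_left : p ⊓ q ≤ p) = l ≫ res F (inf_le_right : p ⊓ q ≤ q) := by
    rw [← cancel_epi t.hom, reassoc_of% hk, reassoc_of% hl, toSection_comp_res,
      toSection_comp_res]
  refine ⟨sq.lift k l hkl, sq.hom_ext ?_ ?_⟩
  · rw [Category.assoc, sq.lift_fst, hk, toSection_comp_res]
  · rw [Category.assoc, sq.lift_snd, hl, toSection_comp_res]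

lemma preservesInfOf_softQuotient (hks : IsKSheaf F) {S : Set Q} (hS : S.Finite) :
    PreservesInfOf (softQuotient hsoft φ) S := by
  refine ⟨fun p hp => softQuotient_le hsoft φ (le_sSup hp), fun t => ?_⟩
  induction S, hS using Set.Finite.induction_on with
  | empty =>
    intro _
    rw [sSup_empty]
    exact le_softQuotient_bot hsoft φ hks t
  | insert _ _ ih =>
    intro ht
    rw [sSup_insert]
    exact le_softQuotient_sup hsoft φ hks (ht _ (Set.mem_insert _ _))
      (ih fun p hp => ht p (Set.mem_insert_of_mem _ hp))

variable [RegularCat D]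

lemma softQuotient_inf_le (hks : IsKSheaf F) {t : RegEpiOver A} {p q : Q}
    (hp : (softQuotient hsoft φ p).le t) (hq : (softQuotient hsoft φ q).le t) :
    (softQuotient hsoft φ (p ⊓ q)).le t := by
  rw [softQuotient_le_iff] at hp hq ⊢
  obtain ⟨k, hk⟩ := hp
  obtain ⟨l, hl⟩ := hq
  have := hsoft.isRegularEpi_res (inf_le_left : p ⊓ q ≤ p)
  have := hsoft.isRegularEpi_res (inf_le_right : p ⊓ q ≤ q)
  have := hsoft.isRegularEpi_toSection φ (p ⊔ q)
  obtain ⟨m, hm⟩ := (hks.2.1 p q).exists_desc k l (by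
    rw [← cancel_epi (toSection φ (p ⊔ q)), ← Category.assoc, ← Category.assoc,
      toSection_comp_res, toSection_comp_res, hk, hl])
  refine ⟨m, ?_⟩
  rw [← toSection_comp_res φ (inf_le_left : p ⊓ q ≤ p), Category.assoc, hm, hk]

lemma preservesSupOf_softQuotient (hks : IsKSheaf F) (S : Set Q) :
    PreservesSupOf (softQuotient hsoft φ) S := by
  refine ⟨fun p hp => softQuotient_le hsoft φ (sInf_le hp), fun t ht => ?_⟩
  let E : Set Q := {p | sInf S ≤ p ∧ (softQuotient hsoft φ p).le t}
  have htop : ⊤ ∈ E := ⟨le_top, softQuotient_top_le hsoft φ t⟩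
  have hdir : DirectedOn (· ≥ ·) E := fun p hp q hq =>
    ⟨p ⊓ q, ⟨le_inf hp.1 hq.1, softQuotient_inf_le hsoft φ hks hp.2 hq.2⟩,
      inf_le_left, inf_le_right⟩
  have hE : sInf E = sInf S :=
    le_antisymm (le_sInf fun p hp => sInf_le ⟨sInf_le hp, ht p hp⟩) (le_sInf fun p hp => hp.1)
  choose c hc using fun (p : Q) (hp : p ∈ E) => (softQuotient_le_iff hsoft φ).1 hp.2
  obtain ⟨u, hu, -⟩ := hks.2.2 E ⟨⊤, htop⟩ hdir t.cod c fun p q hp hq hpq => by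
    have := hsoft.isRegularEpi_toSection φ q
    rw [← cancel_epi (toSection φ q), ← Category.assoc, toSection_comp_res, hc p hp, hc q hq]
  rw [← hE, softQuotient_le_iff]
  refine ⟨u, ?_⟩
  rw [← toSection_comp_res φ (sInf_le htop), Category.assoc, hu ⊤ htop, hc ⊤ htop]

lemma isRelComp_softQuotient (hks : IsKSheaf F) (p q : Q) :
    IsRelComp (kerPairMap (softQuotient hsoft φ p).hom) (kerPairMap (softQuotient hsoft φ q).hom)
      (kerPairMap (softQuotient hsoft φ (p ⊓ q)).hom) :=
  have := hsoft.isRegularEpi_toSection φ (p ⊔ q)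
  (hks.2.1 p q).isRelComp_kerPairMap (toSection φ (p ⊔ q)) (toSection_comp_res φ _)
    (toSection_comp_res φ _) (toSection_comp_res φ _) (toSection_comp_res φ _)

lemma kerCommute_softQuotient (hks : IsKSheaf F) (p q : Q) :
    KerCommute (softQuotient hsoft φ p) (softQuotient hsoft φ q) := by
  refine ⟨_, kerPairMap (softQuotient hsoft φ (p ⊓ q)).hom, inferInstance,
    isRelComp_softQuotient hsoft φ hks p q, ?_,
    _, (softQuotient hsoft φ (p ⊓ q)).hom, ⟨𝟙 _, by simp⟩, ⟨𝟙 _, by simp⟩⟩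
  rw [inf_comm]
  exact isRelComp_softQuotient hsoft φ hks q p

end Representation


theorem statement8 [RegularCat C] {A : C}
    (F : Pᵒᵖ ⥤ C) (hks : IsKSheaf F) (hsoft : IsSoft F)
    (φ : A ⟶ F.obj (op (⊤ : P))) (hiso : IsIso φ) :
    -- H_F : P^op → RegEpi(A), p ↦ φ ≫ (F(⊤) → F(p))
    ∃ HF : P → RegEpiOver A,
      (∀ p : P, (HF p).cod = F.obj (op p)) ∧
      (∀ (p : P) (hc : (HF p).cod = F.obj (op p)),
        (HF p).hom = (φ ≫ res F (le_top : p ≤ ⊤)) ≫ eqToHom hc.symm) ∧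
      -- (a) γ_*H_F = F : the restriction maps of F are the restriction maps of γ_*H_F
      (∀ (p q : P) (h : p ≤ q)
          (hcq : (HF q).cod = F.obj (op q)) (hcp : (HF p).cod = F.obj (op p)),
        (HF q).hom ≫ (eqToHom hcq ≫ res F h ≫ eqToHom hcp.symm) = (HF p).hom) ∧
      -- (b) H_F preserves finite infima and arbitrary suprema, and its image consists
      -- of pairwise ker-commuting elements
      (∀ S : Set P, S.Finite → PreservesInfOf HF S) ∧
      (∀ S : Set P, PreservesSupOf HF S) ∧
      (∀ p q : P, KerCommute (HF p) (HF q)) := by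
  refine ⟨softQuotient hsoft φ, fun _ => rfl, fun p _ => ?_, fun p q h _ _ => ?_,
    fun S hS => preservesInfOf_softQuotient hsoft φ hks hS,
    preservesSupOf_softQuotient hsoft φ hks, kerCommute_softQuotient hsoft φ hks⟩
  · exact (Category.comp_id _).symm
  · change toSection φ q ≫ 𝟙 _ ≫ res F h ≫ 𝟙 _ = toSection φ p
    rw [Category.comp_id, Category.id_comp, toSection_comp_res]
end
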